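/- (Big-step versus small-step reorderings.) For all histories h₁, h₂ ∈ H_{Θ,Θ'}: h₁ ◁_{PO}^big h₂ if and only if h₁ ◁_{PO}^* h₂. That is, the single-permutation (big-step) reordering relation coincides with the reflexive-transitive closure of the adjacent-swap relation ◁_{PO}. -/

import Mathlib

namespace HOLin

/-- Types of the higher-order language: θ ::= unit | int | θ×θ | θ→θ. -/
inductive Ty : Type
  | unit : Ty
  | int : Ty
  | prod : Ty → Ty → Ty
  | arrow : Ty → Ty → Ty
deriving DecidableEq

/-- Order of a type. -/
def Ty.ord : Ty → ℕ
  | .unit => 0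
  | .int => 0
  | .prod a b => max a.ord b.ord
  | .arrow a b => max (a.ord + 1) b.ord

/-- Method names: each name carries its argument and result type,
so that `Meths = ⊎_{θ,θ'} Meths_{θ,θ'}` (all names are function-typed). -/
structure MethodName : Type where
  id : ℕ
  arg : Ty
  res : Ty
deriving DecidableEq

/-- A method name (of type θ→θ') is first-order when ord(θ→θ') = 1. -/
def MethodName.FirstOrder (m : MethodName) : Prop :=
  (Ty.arrow m.arg m.res).ord = 1

/-- Values: v ::= () | i | m | (v,v). -/
inductive Value : Type
  | unit : Value
  | int : ℤ → Value
  | meth : MethodName → Value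
  | pair : Value → Value → Value
deriving DecidableEq

/-- Method names occurring in a value. -/
def Value.names : Value → Finset MethodName
  | .unit => ∅
  | .int _ => ∅
  | .meth m => {m}
  | .pair v w => v.names ∪ w.names

/-- Typing of values. -/
inductive HasTy : Value → Ty → Prop
  | unit : HasTy .unit .unit
  | int (i : ℤ) : HasTy (.int i) .int
  | meth (m : MethodName) : HasTy (.meth m) (.arrow m.arg m.res)
  | pair {v w : Value} {a b : Ty} :
      HasTy v a → HasTy w b → HasTy (.pair v w) (.prod a b)

/-- Polarities O / P. -/
inductive Pol : Type
  | O : Pol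
  | P : Pol
deriving DecidableEq

/-- Component tags k / l. -/
inductive Tag : Type
  | k : Tag
  | l : Tag
deriving DecidableEq

def Pol.swap : Pol → Pol
  | .O => .P
  | .P => .O

/-- Actions: calls and returns. -/
inductive Act : Type
  | call : MethodName → Value → Act
  | ret : MethodName → Value → Act
deriving DecidableEq

def Act.meth : Act → MethodName
  | .call m _ => m
  | .ret m _ => m

def Act.value : Act → Value
  | .call _ v => v
  | .ret _ v => v

def Act.IsCall : Act → Prop
  | .call _ _ => True
  | .ret _ _ => False

/-- Moves (t, a)_{XY}. -/
structure Move : Type where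
  thread : ℕ
  act : Act
  pol : Pol
  tag : Tag
deriving DecidableEq

abbrev History := List Move

/-- O/P complement h̄ of a move sequence. -/
def complement (h : History) : History :=
  h.map fun a => { a with pol := a.pol.swap }

/-- Restriction h↾Y to the moves with a given component tag. -/
def restrictTag (h : History) (Y : Tag) : History :=
  h.filter fun a => a.tag = Y

/-- Projection onto a thread. -/
def threadProj (h : History) (t : ℕ) : History :=
  h.filter fun a => a.thread = t

mutual
  /-- O-starting prehistories (for a single thread). -/
  inductive PreO : History → Prop
    | nil : PreO []
    | cons (t : ℕ) (m : MethodName) (v v' : Value) (Y : Tag) (hp ho : History) :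
        HasTy v m.arg → HasTy v' m.res → PreP hp → PreO ho →
        PreO (Move.mk t (Act.call m v) Pol.O Y ::
          (hp ++ Move.mk t (Act.ret m v') Pol.P Y :: ho))
  /-- P-starting prehistories (for a single thread). -/
  inductive PreP : History → Prop
    | nil : PreP []
    | cons (t : ℕ) (m : MethodName) (v v' : Value) (Y : Tag) (ho hp : History) :
        HasTy v m.arg → HasTy v' m.res → PreO ho → PreP hp →
        PreP (Move.mk t (Act.call m v) Pol.P Y ::
          (ho ++ Move.mk t (Act.ret m v') Pol.O Y :: hp))
end

/-- Histories over Θ → Θ': interleavings of thread-tagged O-starting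
prehistories (one per thread, threads numbered from 1), subject to the two
name conditions. -/
def Histories (Θ Θ' : Finset MethodName) : Set History :=
  { h |
    (∀ a ∈ h, 1 ≤ a.thread) ∧
    (∀ t : ℕ, PreO (threadProj h t)) ∧
    (∀ s₁ (a : Move) s₂, h = s₁ ++ a :: s₂ → ∀ m v, a.act = Act.call m v →
      (m ∈ Θ' ∧ a.pol = Pol.O ∧ a.tag = Tag.k) ∨
      (m ∈ Θ ∧ a.pol = Pol.P ∧ a.tag = Tag.l) ∨
      (∃ b ∈ s₁, b.tag = a.tag ∧ b.pol ≠ a.pol ∧ m ∈ b.act.value.names)) ∧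
    (∀ s₁ (a : Move) s₂, h = s₁ ++ a :: s₂ →
      ∀ m ∈ a.act.value.names, ∀ b ∈ s₁, b.act.meth ≠ m ∧ m ∉ b.act.value.names) }

/-- Co-histories H^co_{Θ,Θ'}. -/
def CoHistories (Θ Θ' : Finset MethodName) : Set History :=
  { h | complement h ∈ Histories Θ Θ' }

/-- Sequential histories: every O-move is immediately followed by a P-move of
the same thread. -/
inductive Seqn : History → Prop
  | nil : Seqn []
  | cons (a b : Move) (h : History) :
      a.pol = Pol.O → b.pol = Pol.P → a.thread = b.thread →
      Seqn h → Seqn (a :: b :: h)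

/-- Encapsulated histories: inside a thread, P never switches component. -/
def Encapsulated (h : History) : Prop :=
  ∀ s₁ s₂ s₃ (a b : Move), h = s₁ ++ a :: (s₂ ++ b :: s₃) →
    a.pol = Pol.P → b.pol = Pol.O → a.thread = b.thread →
    (∀ c ∈ s₂, c.thread ≠ a.thread) → a.tag = b.tag

/-- The reordering relation ◁_{XX'} (adjacent transpositions of moves of
different threads, moving an X-move earlier or an X'-move later). -/
inductive Swap (X X' : Pol) : History → History → Prop
  | swap (s₁ s₂ : History) (a b : Move) :
      a.thread ≠ b.thread → (a.pol = X' ∨ b.pol = X) →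
      Swap X X' (s₁ ++ a :: b :: s₂) (s₁ ++ b :: a :: s₂)

/-- ◁_{XX'}^*. -/
def SwapStar (X X' : Pol) : History → History → Prop :=
  Relation.ReflTransGen (Swap X X')

/-- The symmetric reordering ◇ between moves of different components and
different threads. -/
inductive Diamond : History → History → Prop
  | swap (s₁ s₂ : History) (a b : Move) :
      a.thread ≠ b.thread → a.tag ≠ b.tag →
      Diamond (s₁ ++ a :: b :: s₂) (s₁ ++ b :: a :: s₂)

/-- General linearisation of histories: h₁ ◁ h₂ iff h₁ ◁_{PO}^* h₂. -/
def LinGenH (h₁ h₂ : History) : Prop :=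
  SwapStar Pol.P Pol.O h₁ h₂

/-- Encapsulated linearisation of histories: h₁ ◁_enc h₂. -/
def LinEncH (h₁ h₂ : History) : Prop :=
  Relation.ReflTransGen (fun x y => Swap Pol.P Pol.O x y ∨ Diamond x y) h₁ h₂ ∧
  Seqn h₂

/-- Relational linearisation of histories: h₁ ◁_R h₂. -/
def LinRelH (R : History → History → Prop) (h₁ h₂ : History) : Prop :=
  Seqn h₂ ∧
  SwapStar Pol.P Pol.O (restrictTag h₁ Tag.k) (restrictTag h₂ Tag.k) ∧
  R (restrictTag (complement h₁) Tag.l) (restrictTag (complement h₂) Tag.l)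

/-- Renaming of method names in values. -/
def Value.rename (π : MethodName → MethodName) : Value → Value
  | .unit => .unit
  | .int i => .int i
  | .meth m => .meth (π m)
  | .pair v w => .pair (v.rename π) (w.rename π)

def Act.rename (π : MethodName → MethodName) : Act → Act
  | .call m v => .call (π m) (v.rename π)
  | .ret m v => .ret (π m) (v.rename π)

def Move.rename (π : MethodName → MethodName) (a : Move) : Move :=
  { a with act := a.act.rename π }

def History.rename (π : MethodName → MethodName) (h : History) : History :=
  h.map (Move.rename π)

/-- R is closed under type-preserving permutations of method names outside Θ. -/
def PermClosed (Θ : Finset MethodName) (R : History → History → Prop) : Prop :=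
  ∀ π : Equiv.Perm MethodName,
    (∀ m ∈ Θ, π m = m) →
    (∀ m : MethodName, (π m).arg = m.arg ∧ (π m).res = m.res) →
    ∀ h h', R h h' → R (History.rename π h) (History.rename π h')

/-- The syntax and operational/trace semantics of the higher-order concurrent
library language of the paper, packaged as a structure. -/
structure Lang : Type 1 where
  /-- libraries -/
  Library : Type
  /-- closed client threads -/
  Term : Type
  /-- `LibTy L Θ Θ'` : the library L has type Θ → Θ'. -/
  LibTy : Library → Finset MethodName → Finset MethodName → Prop
  /-- `ClientTy Θ Ms` : Θ ⊢ M₁‖⋯‖M_N : unit. -/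
  ClientTy : Finset MethodName → List Term → Prop
  /-- the two libraries access disjoint parts of the store -/
  StoreDisjointLib : Library → Library → Prop
  /-- the library and the client access disjoint parts of the store -/
  StoreDisjointClient : Library → List Term → Prop
  /-- `linkTerminates L Ms` : link L (M₁‖⋯‖M_N) ⇓. -/
  linkTerminates : Library → List Term → Prop
  /-- `seqComp L' L` : the sequencing L' ∘ L = (L' ∪ L) ∖ Θ₁. -/
  seqComp : Library → Library → Library
  /-- union of libraries -/
  union : Library → Library → Library
  /-- the empty library -/
  emptyLib : Library
  /-- `sem L N` : the N-thread trace semantics ⟦L⟧_N. -/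
  sem : Library → ℕ → Set History
  /-- `ctxSem L' Ms` : the context semantics ⟦link (L'∘−)(M₁‖⋯‖M_N)⟧. -/
  ctxSem : Library → List Term → Set History

/-- ⟦L⟧ = ∪_N ⟦L⟧_N. -/
def Lang.semAll (Λ : Lang) (L : Λ.Library) : Set History :=
  ⋃ N : ℕ, Λ.sem L N

/-- ⟦L⟧^enc = ⟦L⟧ ∩ H^enc. -/
def Lang.encSem (Λ : Lang) (L : Λ.Library) : Set History :=
  { h ∈ Λ.semAll L | Encapsulated h }

/-- General linearisability of libraries: L₁ ◁ L₂. -/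
def Lang.GenLin (Λ : Lang) (L₁ L₂ : Λ.Library) : Prop :=
  ∀ h ∈ Λ.semAll L₁, ∃ h' ∈ Λ.semAll L₂, Seqn h' ∧ LinGenH h h'

/-- Enc-linearisability of libraries: L₁ ◁_enc L₂. -/
def Lang.EncLin (Λ : Lang) (L₁ L₂ : Λ.Library) : Prop :=
  ∀ h ∈ Λ.encSem L₁, ∃ h' ∈ Λ.encSem L₂, LinEncH h h'

/-- Relational linearisability of libraries: L₁ ◁_R L₂. -/
def Lang.RelLin (Λ : Lang) (R : History → History → Prop) (L₁ L₂ : Λ.Library) :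
    Prop :=
  ∀ h ∈ Λ.encSem L₁, ∃ h' ∈ Λ.encSem L₂, LinRelH R h h'

/-- R-closed parameter library. -/
def Lang.RClosedLib (Λ : Lang) (R : History → History → Prop) (L' : Λ.Library) :
    Prop :=
  ∀ h h', R h h' → h ∈ Λ.semAll L' → h' ∈ Λ.semAll L'

/-- General contextual approximation L₁ ≲ L₂ (L₂ contextually refines L₁). -/
def Lang.GenApprox (Λ : Lang) (Θ Θ' : Finset MethodName) (L₁ L₂ : Λ.Library) :
    Prop :=
  ∀ (Θ'' : Finset MethodName) (L' : Λ.Library) (Ms : List Λ.Term),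
    Disjoint Θ Θ'' →
    Λ.LibTy L' ∅ (Θ ∪ Θ'') →
    Λ.ClientTy (Θ' ∪ Θ'') Ms →
    Λ.StoreDisjointLib L₁ L' → Λ.StoreDisjointLib L₂ L' →
    Λ.StoreDisjointClient L₁ Ms → Λ.StoreDisjointClient L₂ Ms →
    Λ.StoreDisjointClient L' Ms →
    Λ.linkTerminates (Λ.seqComp L' L₁) Ms →
    Λ.linkTerminates (Λ.seqComp L' L₂) Ms

/-- Encapsulated contextual approximation L₁ ≲_enc L₂. -/
def Lang.EncApprox (Λ : Lang) (Θ Θ' : Finset MethodName) (L₁ L₂ : Λ.Library) :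
    Prop :=
  ∀ (L' : Λ.Library) (Ms : List Λ.Term),
    Λ.LibTy L' ∅ Θ →
    Λ.ClientTy Θ' Ms →
    Λ.StoreDisjointLib L₁ L' → Λ.StoreDisjointLib L₂ L' →
    Λ.StoreDisjointClient L₁ Ms → Λ.StoreDisjointClient L₂ Ms →
    Λ.StoreDisjointClient L' Ms →
    Λ.linkTerminates (Λ.seqComp L' L₁) Ms →
    Λ.linkTerminates (Λ.seqComp L' L₂) Ms

/-- Contextual approximation with respect to R-closed encapsulated contexts:
L₁ ≲_R L₂. -/
def Lang.RelApprox (Λ : Lang) (Θ Θ' : Finset MethodName)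
    (R : History → History → Prop) (L₁ L₂ : Λ.Library) : Prop :=
  ∀ (L' : Λ.Library) (Ms : List Λ.Term),
    Λ.RClosedLib R L' →
    Λ.LibTy L' ∅ Θ →
    Λ.ClientTy Θ' Ms →
    Λ.StoreDisjointLib L₁ L' → Λ.StoreDisjointLib L₂ L' →
    Λ.StoreDisjointClient L₁ Ms → Λ.StoreDisjointClient L₂ Ms →
    Λ.StoreDisjointClient L' Ms →
    Λ.linkTerminates (Λ.seqComp L' L₁) Ms →
    Λ.linkTerminates (Λ.seqComp L' L₂) Ms

/-- Big-step reordering h₁ ◁_{PO}^big h₂: a single permutation of the moves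
preserving the order of moves within each thread and the order of every
P-move before a later O-move. -/
def BigPO (h₁ h₂ : History) : Prop :=
  ∃ e : h₁.length = h₂.length, ∃ π : Equiv.Perm (Fin h₁.length),
    (∀ j : Fin h₁.length, h₁.get j = h₂.get (Fin.cast e (π j))) ∧
    ∀ i j : Fin h₁.length, i < j →
      ((h₁.get i).thread = (h₁.get j).thread ∨
        ((h₁.get i).pol = Pol.P ∧ (h₁.get j).pol = Pol.O)) →
      π i < π j

/-- Two moves, in this order, whose order every PO-reordering must preserve. -/
def OrderFixed (a b : Move) : Prop :=
  a.thread = b.thread ∨ (a.pol = Pol.P ∧ b.pol = Pol.O)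

theorem not_orderFixed_iff {a b : Move} :
    ¬ OrderFixed a b ↔ a.thread ≠ b.thread ∧ (a.pol = Pol.O ∨ b.pol = Pol.P) := by
  unfold OrderFixed
  cases a.pol <;> cases b.pol <;> simp

theorem SwapStar.cons {X X' : Pol} {h h' : History} (a : Move) (hs : SwapStar X X' h h') :
    SwapStar X X' (a :: h) (a :: h') := by
  refine Relation.ReflTransGen.lift (a :: ·) ?_ _ _ hs
  rintro _ _ ⟨s₁, s₂, b, c, hne, hp⟩
  exact Swap.swap (a :: s₁) s₂ b c hne hp

section Sorting

variable {ι : Type*} (f : ι → Move) (r : ι → ι → Prop) [DecidableRel r]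

theorem swapStar_map_orderedInsert (x : ι) (l : List ι)
    (hx : ∀ y ∈ l, OrderFixed (f x) (f y) → r x y) :
    SwapStar Pol.P Pol.O ((x :: l).map f) ((l.orderedInsert r x).map f) := by
  induction l with
  | nil => exact Relation.ReflTransGen.refl
  | cons y l ih =>
    by_cases hxy : r x y
    · rw [List.orderedInsert_cons, if_pos hxy]
      exact Relation.ReflTransGen.refl
    · rw [List.orderedInsert_cons, if_neg hxy]
      obtain ⟨hne, hp⟩ := not_orderFixed_iff.1 (mt (hx y (by simp)) hxy)
      exact Relation.ReflTransGen.head (Swap.swap [] (l.map f) (f x) (f y) hne hp)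
        (SwapStar.cons (f y) (ih fun z hz => hx z (List.mem_cons_of_mem y hz)))

theorem swapStar_map_insertionSort (l : List ι)
    (hl : l.Pairwise fun x y => OrderFixed (f x) (f y) → r x y) :
    SwapStar Pol.P Pol.O (l.map f) ((l.insertionSort r).map f) := by
  induction l with
  | nil => exact Relation.ReflTransGen.refl
  | cons x l ih =>
    obtain ⟨hx, hl⟩ := List.pairwise_cons.1 hl
    exact Relation.ReflTransGen.trans (SwapStar.cons (f x) (ih hl))
      (swapStar_map_orderedInsert f r x _ fun y hy =>
        hx y ((List.perm_insertionSort r l).mem_iff.1 hy))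

end Sorting

theorem SwapStar.of_bigPO {h₁ h₂ : History} (h : BigPO h₁ h₂) :
    SwapStar Pol.P Pol.O h₁ h₂ := by
  obtain ⟨e, π, hget, hmono⟩ := h
  let r : Fin h₁.length → Fin h₁.length → Prop := fun i j => π i ≤ π j
  have : Std.Total r := ⟨fun i j => le_total (π i) (π j)⟩
  have : IsTrans _ r := ⟨fun i j k => le_trans (a := π i) (b := π j) (c := π k)⟩
  have hsort : (List.finRange h₁.length).insertionSort r =
      (List.finRange h₁.length).map π.symm := by
    refine List.Perm.eq_of_pairwise (le := r)
      (fun i j _ _ hij hji => π.injective (le_antisymm hij hji))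
      (List.pairwise_insertionSort r _) ?_ ?_
    · rw [List.pairwise_map]
      refine (List.pairwise_lt_finRange _).imp fun {i j} hij => ?_
      simpa [r] using hij.le
    · exact (List.perm_insertionSort r _).trans (Equiv.Perm.map_finRange_perm π.symm).symm
  have key := swapStar_map_insertionSort h₁.get r (List.finRange h₁.length)
    ((List.pairwise_lt_finRange _).imp fun {i j} hij hf => (hmono i j hij hf).le)
  have hh₂ : ((List.finRange h₁.length).map π.symm).map h₁.get = h₂ := by
    apply List.ext_get
    · simpa using e
    · intro n hn hn'
      simpa using hget (π.symm ⟨n, e ▸ hn'⟩)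
  rwa [hsort, hh₂, List.map_get_finRange] at key

/-- Reorderings of an indexed sequence of moves are witnessed by reorderings of the indices
inverting no pair whose order is fixed. -/
theorem SwapStar.exists_perm {ι : Type*} [Preorder ι] (f : ι → Move) {l : List ι}
    (hl : l.Pairwise (· < ·)) {h : History} (hs : SwapStar Pol.P Pol.O (l.map f) h) :
    ∃ l' : List ι, l'.Perm l ∧ h = l'.map f ∧
      l'.Pairwise fun i j => OrderFixed (f j) (f i) → ¬ j < i := by
  induction hs with
  | refl => exact ⟨l, .refl l, rfl, hl.imp fun hij => fun (_ : OrderFixed _ _) => lt_asymm hij⟩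
  | tail _ hswap ih =>
    obtain ⟨l', hperm, hmap, hpw⟩ := ih
    obtain ⟨s₁, s₂, a, b, hne, hp⟩ := hswap
    obtain ⟨t₁, u, rfl, rfl, hu⟩ := List.map_eq_append_iff.1 hmap.symm
    obtain ⟨i, v, rfl, rfl, hv⟩ := List.map_eq_cons_iff.1 hu
    obtain ⟨j, t₂, rfl, rfl, rfl⟩ := List.map_eq_cons_iff.1 hv
    refine ⟨t₁ ++ j :: i :: t₂,
      ((List.Perm.swap i j t₂).append_left t₁).trans hperm, by simp, ?_⟩
    have hij : ¬ OrderFixed (f i) (f j) := not_orderFixed_iff.2 ⟨hne, hp⟩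
    simp only [List.pairwise_append, List.pairwise_cons, List.mem_cons] at hpw ⊢
    grind

theorem BigPO.of_swapStar {h₁ h₂ : History} (hs : SwapStar Pol.P Pol.O h₁ h₂) :
    BigPO h₁ h₂ := by
  rw [← List.map_get_finRange h₁] at hs
  obtain ⟨l, hperm, rfl, hpw⟩ := SwapStar.exists_perm _ (List.pairwise_lt_finRange _) hs
  have hlen : l.length = h₁.length := by simpa using hperm.length_eq
  let pos : Fin l.length ≃ Fin h₁.length :=
    (hperm.nodup_iff.2 (List.nodup_finRange _)).getEquivOfForallMemList l
      fun i => hperm.mem_iff.2 (List.mem_finRange i)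
  have hpos : ∀ k, pos k = l.get k := fun _ => rfl
  refine ⟨by simp [hlen], pos.symm.trans (finCongr hlen), fun j => ?_, fun i j hij hf => ?_⟩
  · have := hpos (pos.symm j)
    rw [Equiv.apply_symm_apply] at this
    simpa using congrArg h₁.get this
  · change pos.symm i < pos.symm j
    by_contra! hle
    have hlt : pos.symm j < pos.symm i :=
      lt_of_le_of_ne hle (pos.symm.injective.ne hij.ne')
    have := List.pairwise_iff_get.1 hpw _ _ hlt
    rw [← hpos, ← hpos, Equiv.apply_symm_apply, Equiv.apply_symm_apply] at this
    exact this hf hij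

/-- Big-step vs small-step reorderings: on histories,
◁_{PO}^big coincides with ◁_{PO}^*. -/
theorem bigstep_eq_smallstep
    (Θ Θ' : Finset MethodName) (hΘ : Disjoint Θ Θ')
    (h₁ h₂ : History)
    (hh₁ : h₁ ∈ Histories Θ Θ') (hh₂ : h₂ ∈ Histories Θ Θ') :
    BigPO h₁ h₂ ↔ SwapStar Pol.P Pol.O h₁ h₂ :=
  ⟨SwapStar.of_bigPO, BigPO.of_swapStar⟩

end HOLin
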